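/- Fix n ≥ 2 and a field F, and let s_{−1} denote the space of n×n matrices over F supported on the first subdiagonal (A_{ab} = 0 unless a = b + 1). If W ⊆ s_{−1} is a linear subspace on which the matrix commutator vanishes identically (XY − YX = 0 for all X, Y ∈ W), then dim W ≤ ⌊n/2⌋. Moreover, there exists such a subspace W with dim W = ⌊n/2⌋. -/

import Mathlib

/-- The space of `n × n` matrices supported on the first subdiagonal:
`A a b = 0` unless `a = b + 1` (indices read `0`-based). -/
def subdiagOne (n : ℕ) (F : Type*) [Field F] : Submodule F (Matrix (Fin n) (Fin n) F) where
  carrier := {A | ∀ a b : Fin n, (a : ℕ) ≠ (b : ℕ) + 1 → A a b = 0}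
  add_mem' := fun {A B} hA hB a b h => by simp [Matrix.add_apply, hA a b h, hB a b h]
  zero_mem' := fun a b _ => rfl
  smul_mem' := fun c {A} hA a b h => by simp [Matrix.smul_apply, hA a b h]

/-- The entry of a matrix at position `(i + 1, i)`, as a linear functional (zero when out of range). -/
def subdiagEntry (n : ℕ) (F : Type*) [Field F] (i : ℕ) :
    Matrix (Fin n) (Fin n) F →ₗ[F] F :=
  if h : i + 1 < n then Matrix.entryLinearMap F F ⟨i + 1, h⟩ ⟨i, by omega⟩ else 0

theorem subdiagEntry_apply {n : ℕ} {F : Type*} [Field F] {i : ℕ} (h : i + 1 < n)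
    (A : Matrix (Fin n) (Fin n) F) :
    subdiagEntry n F i A = A ⟨i + 1, h⟩ ⟨i, by omega⟩ := by
  simp [subdiagEntry, h]

theorem eq_zero_of_subdiagEntry_eq_zero {n : ℕ} {F : Type*} [Field F]
    {A : Matrix (Fin n) (Fin n) F} (hA : A ∈ subdiagOne n F)
    (h : ∀ i, subdiagEntry n F i A = 0) : A = 0 := by
  ext ⟨a, ha⟩ ⟨b, hb⟩
  by_cases hab : a = b + 1
  · subst hab
    simpa [subdiagEntry_apply ha] using h b
  · exact hA _ _ hab

/-- The second subdiagonal of a product of two matrices on the first subdiagonal. -/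
theorem mul_apply_of_mem_subdiagOne {n : ℕ} {F : Type*} [Field F] {i : ℕ} (h : i + 2 < n)
    {A : Matrix (Fin n) (Fin n) F} (hA : A ∈ subdiagOne n F) (B : Matrix (Fin n) (Fin n) F) :
    (A * B) ⟨i + 2, h⟩ ⟨i, by omega⟩ = subdiagEntry n F (i + 1) A * subdiagEntry n F i B := by
  rw [subdiagEntry_apply h, subdiagEntry_apply (by omega), Matrix.mul_apply]
  refine Finset.sum_eq_single (⟨i + 1, by omega⟩ : Fin n) (fun j _ hj => ?_) (by simp)
  rw [hA _ _ fun h' => hj (Fin.ext (by simp at h' ⊢; omega)), zero_mul]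

theorem subdiagEntry_mul_comm {n : ℕ} {F : Type*} [Field F]
    {A B : Matrix (Fin n) (Fin n) F} (hA : A ∈ subdiagOne n F) (hB : B ∈ subdiagOne n F)
    (hAB : A * B - B * A = 0) (i : ℕ) :
    subdiagEntry n F i A * subdiagEntry n F (i + 1) B =
      subdiagEntry n F i B * subdiagEntry n F (i + 1) A := by
  by_cases h : i + 2 < n
  · have := congrFun (congrFun (sub_eq_zero.mp hAB) ⟨i + 2, h⟩) ⟨i, by omega⟩
    rw [mul_apply_of_mem_subdiagOne h hA, mul_apply_of_mem_subdiagOne h hB] at this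
    linear_combination -this
  · have h0 : subdiagEntry n F (i + 1) = 0 := dif_neg (by omega)
    simp [h0]

/-- Two proportional functionals both vanish on the kernel of a single functional. -/
theorem exists_functional_of_mul_comm {F V : Type*} [Field F] [AddCommGroup V] [Module F V]
    (f g : V →ₗ[F] F) (h : ∀ x y, f x * g y = f y * g x) :
    ∃ l : V →ₗ[F] F, ∀ x, l x = 0 → f x = 0 ∧ g x = 0 := by
  by_cases hf : f = 0
  · exact ⟨g, fun x hx => ⟨by simp [hf], hx⟩⟩
  · obtain ⟨y, hy⟩ : ∃ y, f y ≠ 0 := by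
      by_contra! h0
      exact hf (LinearMap.ext h0)
    refine ⟨f, fun x hx => ⟨hx, ?_⟩⟩
    have := h x y
    rw [hx, zero_mul] at this
    exact (mul_eq_zero.mp this.symm).resolve_left hy

theorem finrank_le_of_commute_subdiagOne {n : ℕ} {F : Type*} [Field F]
    (W : Submodule F (Matrix (Fin n) (Fin n) F)) (hW : W ≤ subdiagOne n F)
    (hcomm : ∀ x ∈ W, ∀ y ∈ W, x * y - y * x = 0) : Module.finrank F W ≤ n / 2 := by
  have hl : ∀ k : ℕ, ∃ l : W →ₗ[F] F, ∀ x : W, l x = 0 →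
      subdiagEntry n F (2 * k) x = 0 ∧ subdiagEntry n F (2 * k + 1) x = 0 := fun k =>
    exists_functional_of_mul_comm ((subdiagEntry n F (2 * k)).comp W.subtype)
      ((subdiagEntry n F (2 * k + 1)).comp W.subtype) fun x y =>
        subdiagEntry_mul_comm (hW x.2) (hW y.2) (hcomm x x.2 y y.2) (2 * k)
  choose l hl using hl
  have hinj : Function.Injective (LinearMap.pi fun k : Fin (n / 2) => l k) := by
    rw [injective_iff_map_eq_zero]
    intro x hx
    refine Subtype.ext (eq_zero_of_subdiagEntry_eq_zero (hW x.2) fun i => ?_)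
    by_cases hi : i + 1 < n
    · have hk := hl (i / 2) x (congrFun hx ⟨i / 2, by omega⟩)
      rcases Nat.mod_two_eq_zero_or_one i with h | h
      · rw [show i = 2 * (i / 2) by omega]
        exact hk.1
      · rw [show i = 2 * (i / 2) + 1 by omega]
        exact hk.2
    · simp [subdiagEntry, hi]
  simpa using LinearMap.finrank_le_finrank_of_injective hinj

/-- The matrices on the first subdiagonal whose entries in odd columns vanish, parametrized by
their entries in even columns. -/
def evenSubdiag (n : ℕ) (F : Type*) [Field F] :
    (Fin (n / 2) → F) →ₗ[F] Matrix (Fin n) (Fin n) F where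
  toFun c := Matrix.of fun a b =>
    if h : (a : ℕ) = b + 1 ∧ (b : ℕ) % 2 = 0 then c ⟨b / 2, by omega⟩ else 0
  map_add' c d := by
    ext a b
    by_cases h : (a : ℕ) = b + 1 ∧ (b : ℕ) % 2 = 0 <;> simp [h]
  map_smul' r c := by
    ext a b
    by_cases h : (a : ℕ) = b + 1 ∧ (b : ℕ) % 2 = 0 <;> simp [h]

theorem evenSubdiag_apply_of_not {n : ℕ} {F : Type*} [Field F] (c : Fin (n / 2) → F)
    {a b : Fin n} (h : ¬((a : ℕ) = b + 1 ∧ (b : ℕ) % 2 = 0)) : evenSubdiag n F c a b = 0 :=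
  dif_neg h

theorem evenSubdiag_mul {n : ℕ} {F : Type*} [Field F] (c d : Fin (n / 2) → F) :
    evenSubdiag n F c * evenSubdiag n F d = 0 := by
  ext a b
  rw [Matrix.mul_apply]
  refine Finset.sum_eq_zero fun j _ => ?_
  by_cases h : (a : ℕ) = j + 1 ∧ (j : ℕ) % 2 = 0
  · rw [evenSubdiag_apply_of_not d (by omega), mul_zero]
  · rw [evenSubdiag_apply_of_not c h, zero_mul]

theorem evenSubdiag_injective (n : ℕ) (F : Type*) [Field F] :
    Function.Injective (evenSubdiag n F) := by
  intro c d hcd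
  ext k
  have := congrFun (congrFun hcd ⟨2 * k + 1, by omega⟩) ⟨2 * k, by omega⟩
  simpa [evenSubdiag] using this

/-- Any subspace `W` of the first subdiagonal on which the matrix commutator vanishes
identically has dimension at most `⌊n/2⌋`, and there is such a subspace of dimension
exactly `⌊n/2⌋`. -/
theorem abelian_subdiagonal_dim (n : ℕ) (hn : 2 ≤ n) (F : Type*) [Field F] :
    (∀ W : Submodule F (Matrix (Fin n) (Fin n) F), W ≤ subdiagOne n F →
      (∀ x ∈ W, ∀ y ∈ W, x * y - y * x = 0) → Module.finrank F W ≤ n / 2) ∧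
    (∃ W : Submodule F (Matrix (Fin n) (Fin n) F), W ≤ subdiagOne n F ∧
      (∀ x ∈ W, ∀ y ∈ W, x * y - y * x = 0) ∧ Module.finrank F W = n / 2) := by
  refine ⟨finrank_le_of_commute_subdiagOne, LinearMap.range (evenSubdiag n F), ?_, ?_, ?_⟩
  · rintro _ ⟨c, rfl⟩ a b hab
    exact evenSubdiag_apply_of_not c fun h => hab h.1
  · rintro _ ⟨c, rfl⟩ _ ⟨d, rfl⟩
    rw [evenSubdiag_mul, evenSubdiag_mul, sub_zero]
  · simpa using LinearMap.finrank_range_of_inj (evenSubdiag_injective n F)
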